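/- Theorem 1.5 (convergence in law under the uniform measure, test-function form). Fix an integer k ≥ 2. For every bounded continuous function f : ℂ → ℝ, the average (1/φ(q)) · Σ_χ f(χ(k)), the sum running over all Dirichlet characters χ mod q, tends, as q → ∞ along integers q coprime to k, to ∫₀¹ f(exp(2πi·u)) du. In other words, under the uniform probability measure on Dirichlet characters mod q, the random variable χ ↦ χ(k) converges in distribution to a uniformly distributed point exp(2πi·U) on the unit circle, U uniform on [0,1]. -/

import Mathlib

open Filter MeasureTheory Complex Topology

/-- The angle (as a point of `ℝ / ℤ`) of the character value `χ(k)`. -/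
noncomputable def charAngle (k q : ℕ) (χ : DirichletCharacter ℂ q) : AddCircle (1 : ℝ) :=
  ((Complex.arg (χ (k : ZMod q)) / (2 * Real.pi) : ℝ) : AddCircle (1 : ℝ))

/-- The average of `g` over the angles. -/
noncomputable def charAvg (k : ℕ) (g : C(AddCircle (1 : ℝ), ℂ)) (q : ℕ) : ℂ :=
  (1 / (Nat.totient q : ℂ)) * ∑ χ : DirichletCharacter ℂ q, g (charAngle k q χ)

lemma charAngle_toCircle (k q : ℕ) (h : Nat.Coprime q k) (χ : DirichletCharacter ℂ q) :
    ((AddCircle.toCircle (charAngle k q χ) : Circle) : ℂ) = χ (k : ZMod q) := by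
  have hu : IsUnit (k : ZMod q) := (ZMod.isUnit_iff_coprime k q).2 h.symm
  have hn : ‖χ (k : ZMod q)‖ = 1 := by
    obtain ⟨u, hu⟩ := hu
    rw [← hu]
    exact χ.unit_norm_eq_one u
  have := Complex.norm_mul_exp_arg_mul_I (χ (k : ZMod q))
  rw [hn] at this
  rw [charAngle, AddCircle.toCircle_apply_mk, Circle.coe_exp]
  have h2 : 2 * Real.pi / 1 * ((χ (k : ZMod q)).arg / (2 * Real.pi)) = (χ (k : ZMod q)).arg := by
    have := Real.pi_ne_zero
    field_simp
  rw [h2]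
  simpa using this

lemma charAvg_fourier_pos (k : ℕ) (hk : 2 ≤ k) (n : ℕ) (hn : n ≠ 0) (q : ℕ)
    (h : Nat.Coprime q k) (hq : k ^ n < q) : charAvg k (fourier (n : ℤ)) q = 0 := by
  have : NeZero q := ⟨by omega⟩
  have h1 : ((k ^ n : ℕ) : ZMod q) ≠ 1 := by
    have hk1 : 1 < k ^ n := Nat.one_lt_pow hn (by omega)
    intro h0
    have h0' : ((k ^ n : ℕ) : ZMod q) = ((1 : ℕ) : ZMod q) := by simpa using h0
    rw [ZMod.natCast_eq_natCast_iff] at h0'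
    have := Nat.ModEq.eq_of_lt_of_lt h0' hq (by omega)
    omega
  have h2 := DirichletCharacter.sum_characters_eq_zero ℂ h1
  have h3 : ∀ χ : DirichletCharacter ℂ q,
      (fourier (n : ℤ)) (charAngle k q χ) = χ ((k ^ n : ℕ) : ZMod q) := by
    intro χ
    rw [fourier_apply, AddCircle.toCircle_zsmul]
    simp [charAngle_toCircle k q h χ]
  rw [charAvg]
  simp only [h3]
  rw [h2, mul_zero]

lemma charAvg_fourier_neg (k : ℕ) (n : ℤ) (q : ℕ) (h : charAvg k (fourier n) q = 0) :
    charAvg k (fourier (-n)) q = 0 := by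
  have : charAvg k (fourier (-n)) q = (starRingEnd ℂ) (charAvg k (fourier n) q) := by
    simp only [charAvg, map_mul, map_sum, fourier_neg, map_div₀, map_one, map_natCast]
  rw [this, h, map_zero]

lemma norm_charAvg_le (k : ℕ) (g : C(AddCircle (1 : ℝ), ℂ)) (q : ℕ) (hq : q ≠ 0) :
    ‖charAvg k g q‖ ≤ ‖g‖ := by
  have : NeZero q := ⟨hq⟩
  have hc : Fintype.card (DirichletCharacter ℂ q) = q.totient := by
    rw [← Nat.card_eq_fintype_card]
    exact DirichletCharacter.card_eq_totient_of_hasEnoughRootsOfUnity ℂ q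
  have hp : (0 : ℝ) < q.totient := by
    exact_mod_cast Nat.totient_pos.2 (Nat.pos_of_ne_zero hq)
  have h1 : ‖∑ χ : DirichletCharacter ℂ q, g (charAngle k q χ)‖ ≤ q.totient * ‖g‖ := by
    refine (norm_sum_le _ _).trans ?_
    refine (Finset.sum_le_sum (fun χ _ => g.norm_coe_le_norm _)).trans ?_
    simp [hc]
  rw [charAvg, norm_mul, norm_div, norm_one, Complex.norm_natCast, div_mul_eq_mul_div, one_mul,
    div_le_iff₀ hp]
  linarith

lemma charAvg_add (k : ℕ) (g h : C(AddCircle (1 : ℝ), ℂ)) (q : ℕ) :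
    charAvg k (g + h) q = charAvg k g q + charAvg k h q := by
  simp [charAvg, Finset.sum_add_distrib, mul_add]

lemma charAvg_smul (k : ℕ) (c : ℂ) (g : C(AddCircle (1 : ℝ), ℂ)) (q : ℕ) :
    charAvg k (c • g) q = c * charAvg k g q := by
  simp only [charAvg, ContinuousMap.smul_apply, smul_eq_mul, ← Finset.mul_sum]
  ring

/-- The mean over the circle. -/
noncomputable def circMean (g : C(AddCircle (1 : ℝ), ℂ)) : ℂ :=
  ∫ u in (0 : ℝ)..1, g (u : AddCircle (1 : ℝ))

lemma circ_cont (g : C(AddCircle (1 : ℝ), ℂ)) :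
    Continuous fun u : ℝ => g (u : AddCircle (1 : ℝ)) :=
  g.continuous.comp (AddCircle.continuous_mk' 1)

lemma circMean_add (g h : C(AddCircle (1 : ℝ), ℂ)) :
    circMean (g + h) = circMean g + circMean h := by
  simp only [circMean, ContinuousMap.add_apply]
  exact intervalIntegral.integral_add ((circ_cont g).intervalIntegrable _ _)
    ((circ_cont h).intervalIntegrable _ _)

lemma circMean_smul (c : ℂ) (g : C(AddCircle (1 : ℝ), ℂ)) :
    circMean (c • g) = c * circMean g := by
  simp only [circMean, ContinuousMap.smul_apply, smul_eq_mul]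
  exact intervalIntegral.integral_const_mul _ _

lemma norm_circMean_le (g : C(AddCircle (1 : ℝ), ℂ)) : ‖circMean g‖ ≤ ‖g‖ := by
  have := intervalIntegral.norm_integral_le_of_norm_le_const (a := (0 : ℝ)) (b := 1)
    (f := fun u : ℝ => g (u : AddCircle (1 : ℝ))) (C := ‖g‖)
    (fun u _ => g.norm_coe_le_norm _)
  simpa [circMean] using this

lemma circMean_fourier (n : ℤ) (hn : n ≠ 0) : circMean (fourier n) = 0 := by
  have hc : (2 * Real.pi * Complex.I * n : ℂ) ≠ 0 := by
    have := Real.pi_ne_zero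
    simp [hn, this]
  have h := integral_exp_mul_complex (a := 0) (b := 1) hc
  have h1 : Complex.exp (2 * Real.pi * Complex.I * n) = 1 := by
    rw [Complex.exp_eq_one_iff]
    exact ⟨n, by ring⟩
  simp only [circMean, fourier_coe_apply]
  simp only [Complex.ofReal_one, mul_one, Complex.ofReal_zero, mul_zero, Complex.exp_zero, h1,
    sub_self, zero_div] at h
  simpa using h

lemma charAvg_tendsto_fourier (k : ℕ) (hk : 2 ≤ k) (n : ℤ) :
    Tendsto (charAvg k (fourier n)) (atTop ⊓ 𝓟 {q : ℕ | Nat.Coprime q k})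
      (𝓝 (circMean (fourier n))) := by
  have hev : ∀ N : ℕ, ∀ᶠ q in (atTop ⊓ 𝓟 {q : ℕ | Nat.Coprime q k}),
      Nat.Coprime q k ∧ N < q := fun N => by
    have h1 : ∀ᶠ q in (atTop ⊓ 𝓟 {q : ℕ | Nat.Coprime q k}), Nat.Coprime q k :=
      mem_inf_of_right (mem_principal_self _)
    have h2 : ∀ᶠ q in (atTop ⊓ 𝓟 {q : ℕ | Nat.Coprime q k}), N < q :=
      mem_inf_of_left (eventually_gt_atTop N)
    exact h1.and h2
  by_cases hn : n = 0
  · subst hn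
    have hm : circMean (fourier 0) = 1 := by simp [circMean]
    rw [hm]
    refine tendsto_const_nhds.congr' ?_
    filter_upwards [hev 0] with q hq
    have : NeZero q := ⟨by omega⟩
    have hc : Fintype.card (DirichletCharacter ℂ q) = q.totient := by
      rw [← Nat.card_eq_fintype_card]
      exact DirichletCharacter.card_eq_totient_of_hasEnoughRootsOfUnity ℂ q
    have hp : (q.totient : ℂ) ≠ 0 := by
      exact_mod_cast (Nat.totient_pos.2 hq.2).ne'
    simp [charAvg, hc, hp]
  · rw [circMean_fourier n hn]
    refine tendsto_const_nhds.congr' ?_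
    filter_upwards [hev (k ^ n.natAbs)] with q hq
    have h0 := charAvg_fourier_pos k hk n.natAbs (by omega) q hq.1 hq.2
    rcases Int.natAbs_eq n with h | h
    · rw [h, h0]
    · rw [h, charAvg_fourier_neg k _ q h0]

lemma charAvg_tendsto (k : ℕ) (hk : 2 ≤ k) (g : C(AddCircle (1 : ℝ), ℂ)) :
    Tendsto (charAvg k g) (atTop ⊓ 𝓟 {q : ℕ | Nat.Coprime q k}) (𝓝 (circMean g)) := by
  have : Fact ((0 : ℝ) < 1) := ⟨one_pos⟩
  have hspan : ∀ p ∈ Submodule.span ℂ (Set.range (fourier (T := (1 : ℝ)))),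
      Tendsto (charAvg k p) (atTop ⊓ 𝓟 {q : ℕ | Nat.Coprime q k}) (𝓝 (circMean p)) := by
    intro p hp
    induction hp using Submodule.span_induction with
    | mem x hx =>
      obtain ⟨n, rfl⟩ := hx
      exact charAvg_tendsto_fourier k hk n
    | zero =>
      have h1 : charAvg k 0 = fun _ => 0 := by
        funext q
        simp [charAvg]
      rw [h1]
      have h2 : circMean 0 = 0 := by simp [circMean]
      rw [h2]
      exact tendsto_const_nhds
    | add x y _ _ hx hy =>
      rw [circMean_add, funext (charAvg_add k x y)]
      exact hx.add hy
    | smul c x _ hx =>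
      rw [circMean_smul, funext (charAvg_smul k c x)]
      exact hx.const_mul c
  have hg : g ∈ (Submodule.span ℂ (Set.range (fourier (T := (1 : ℝ))))).topologicalClosure := by
    rw [span_fourier_closure_eq_top]
    trivial
  have hg' : g ∈ closure (Submodule.span ℂ (Set.range (fourier (T := (1 : ℝ)))) :
      Set C(AddCircle (1 : ℝ), ℂ)) := hg
  rw [Metric.tendsto_nhds]
  intro ε hε
  obtain ⟨p, hp, hd⟩ := Metric.mem_closure_iff.1 hg' (ε / 3) (by positivity)
  have h0 : ∀ᶠ q in (atTop ⊓ 𝓟 {q : ℕ | Nat.Coprime q k}), 0 < q :=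
    mem_inf_of_left (eventually_gt_atTop 0)
  filter_upwards [h0, Metric.tendsto_nhds.1 (hspan p hp) (ε / 3) (by positivity)] with q hq hq2
  have e : g = (g - p) + p := by simp
  have e1 : charAvg k g q = charAvg k (g - p) q + charAvg k p q := by
    rw [← charAvg_add, ← e]
  have e2 : circMean g = circMean (g - p) + circMean p := by
    rw [← circMean_add, ← e]
  rw [dist_eq_norm] at hd hq2 ⊢
  have b1 := norm_charAvg_le k (g - p) q hq.ne'
  have b2 := norm_circMean_le (g - p)
  have e3 : charAvg k g q - circMean g =
      (charAvg k (g - p) q - circMean (g - p)) + (charAvg k p q - circMean p) := by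
    rw [e1, e2]
    ring
  rw [e3]
  have b3 := norm_add_le (charAvg k (g - p) q - circMean (g - p)) (charAvg k p q - circMean p)
  have b4 := norm_sub_le (charAvg k (g - p) q) (circMean (g - p))
  linarith

/-- Theorem 1.5, test-function form: under the uniform measure on Dirichlet characters
mod `q`, the evaluation `χ ↦ χ(k)` converges in law, as `q → ∞` along integers coprime
to `k`, to a uniform point `exp(2πi U)` on the unit circle. -/
theorem theorem_1_5_test_function (k : ℕ) (hk : 2 ≤ k)
    (f : BoundedContinuousFunction ℂ ℝ) :
    Tendsto
      (fun q : ℕ =>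
        (1 / (Nat.totient q : ℝ)) *
          ∑ χ : DirichletCharacter ℂ q, f (χ (k : ZMod q)))
      (atTop ⊓ 𝓟 {q : ℕ | Nat.Coprime q k})
      (𝓝 (∫ u in (0:ℝ)..1, f (Complex.exp (2 * Real.pi * Complex.I * u)))) := by
  let g : C(AddCircle (1 : ℝ), ℂ) :=
    ⟨fun x => ((f ((AddCircle.toCircle x : Circle) : ℂ) : ℝ) : ℂ), by
      have h1 : Continuous fun x : AddCircle (1 : ℝ) => ((AddCircle.toCircle x : Circle) : ℂ) :=
        continuous_subtype_val.comp AddCircle.continuous_toCircle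
      exact Complex.continuous_ofReal.comp (f.continuous.comp h1)⟩
  have hg := charAvg_tendsto k hk g
  have hm : circMean g =
      ((∫ u in (0:ℝ)..1, f (Complex.exp (2 * Real.pi * Complex.I * u)) : ℝ) : ℂ) := by
    rw [← intervalIntegral.integral_ofReal]
    simp only [circMean]
    congr 1
    funext u
    change ((f ((AddCircle.toCircle (u : AddCircle (1 : ℝ)) : Circle) : ℂ) : ℝ) : ℂ) = _
    rw [AddCircle.toCircle_apply_mk, Circle.coe_exp]
    congr 3
    push_cast
    ring
  rw [hm] at hg
  have hre := (Complex.continuous_re.tendsto _).comp hg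
  rw [Complex.ofReal_re] at hre
  refine hre.congr' ?_
  have h1 : ∀ᶠ q in (atTop ⊓ 𝓟 {q : ℕ | Nat.Coprime q k}), Nat.Coprime q k :=
    mem_inf_of_right (mem_principal_self _)
  filter_upwards [h1] with q hq
  have : charAvg k g q = (((1 / (Nat.totient q : ℝ)) *
      ∑ χ : DirichletCharacter ℂ q, f (χ (k : ZMod q)) : ℝ) : ℂ) := by
    rw [charAvg]
    push_cast
    congr 1
    refine Finset.sum_congr rfl fun χ _ => ?_
    change ((f ((AddCircle.toCircle (charAngle k q χ) : Circle) : ℂ) : ℝ) : ℂ) = _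
    rw [charAngle_toCircle k q hq χ]
  rw [Function.comp_apply, this, Complex.ofReal_re]
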